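/- Let k be an algebraically closed field of characteristic p = 2, let m ≥ 2 and 0 ≤ s ≤ m−1 be integers, and let R = k⟦x,y,z⟧/(z^2 + x^2 y + z y^m + z x y^{m−s}) (the rational double point of type D_{2m+1}^{s+1/2} in characteristic 2). Set L' := min(m−1, 2m−2s−2). With L and A as in the context: (i) for every integer j ≥ 1 with 2j−1 ≤ L' there exists m' ≥ 0 such that (z/(xy^j))^{2^{m'}} ∈ A; (ii) the images in L/A of the elements z/(xy^j), for integers j ≥ 1 with 2j−1 ≤ L', are k-linearly independent; (iii) for every c ∈ L such that c^{2^{m'}} ∈ A for some m' ≥ 0, there exist a_j ∈ k (for j ≥ 1 with 2j−1 ≤ L') such that c − Σ_j a_j·(z/(xy^j)) ∈ A. In particular, H^2_m(R)[F^∞] has k-dimension ⌊(L'+1)/2⌋. -/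

import Mathlib

set_option maxHeartbeats 1000000
set_option synthInstance.maxHeartbeats 400000

open MvPowerSeries

noncomputable section

variable (k : Type) [Field k]

/-- The formal power series ring `k⟦x,y,z⟧`. -/
abbrev PS := MvPowerSeries (Fin 3) k

/-- The hypersurface singularity `R = k⟦x,y,z⟧/(f)`. -/
abbrev Rq (f : PS k) : Type := PS k ⧸ Ideal.span {f}

/-- The image of `x` in `R`. -/
abbrev xR (f : PS k) : Rq k f := Ideal.Quotient.mk _ (X 0)
/-- The image of `y` in `R`. -/
abbrev yR (f : PS k) : Rq k f := Ideal.Quotient.mk _ (X 1)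
/-- The image of `z` in `R`. -/
abbrev zR (f : PS k) : Rq k f := Ideal.Quotient.mk _ (X 2)

/-- `L`: the localization of `R` inverting `x*y`. -/
abbrev Lloc (f : PS k) : Type := Localization.Away (xR k f * yR k f)

/-- The canonical map from the localization of `R` inverting `x` to `L`. -/
noncomputable def phiX (f : PS k) : Localization.Away (xR k f) →+* Lloc k f :=
  IsLocalization.Away.awayToAwayRight (S := Localization.Away (xR k f)) (P := Lloc k f)
    (xR k f) (yR k f)

/-- The canonical map from the localization of `R` inverting `y` to `L`. -/
noncomputable def phiY (f : PS k) : Localization.Away (yR k f) →+* Lloc k f :=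
  IsLocalization.Away.awayToAwayLeft (S := Localization.Away (yR k f)) (P := Lloc k f)
    (yR k f) (xR k f)

/-- `A ⊆ L`: the `R`-submodule generated by the images of `R_x` and `R_y` in `L`.
The quotient `L/A` is a Čech description of the local cohomology `H^2_m(R)`. -/
def Asub (f : PS k) : Submodule (Rq k f) (Lloc k f) :=
  Submodule.span (Rq k f) (Set.range (phiX k f) ∪ Set.range (phiY k f))

/-- The element `z/(x*y) ∈ L`. -/
noncomputable def zxy (f : PS k) : Lloc k f :=
  Localization.mk (zR k f) ⟨xR k f * yR k f, Submonoid.mem_powers _⟩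

/-- The element `f_j := z/(x*y^j) = z*x^(j-1)/(x*y)^j ∈ L` (for `j ≥ 1`). -/
noncomputable def fcls (f : PS k) (j : ℕ) : Lloc k f :=
  Localization.mk (zR k f * xR k f ^ (j - 1)) ⟨(xR k f * yR k f) ^ j, j, rfl⟩

section

/-- The exponent of the monomial `x^a y^b z^c`. -/
def triExp (a b c : ℕ) : Fin 3 →₀ ℕ :=
  Finsupp.single 0 a + Finsupp.single 1 b + Finsupp.single 2 c

theorem triExp_zero (a b c : ℕ) : triExp a b c 0 = a := by simp [triExp]

theorem triExp_one (a b c : ℕ) : triExp a b c 1 = b := by simp [triExp]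

theorem triExp_two (a b c : ℕ) : triExp a b c 2 = c := by simp [triExp]

theorem eq_triExp (d : Fin 3 →₀ ℕ) : d = triExp (d 0) (d 1) (d 2) := by
  ext i
  fin_cases i <;> simp [triExp]

theorem triExp_le {a b c a' b' c' : ℕ} :
    triExp a b c ≤ triExp a' b' c' ↔ a ≤ a' ∧ b ≤ b' ∧ c ≤ c' := by
  refine ⟨fun h => ⟨?_, ?_, ?_⟩, fun h i => ?_⟩
  · simpa [triExp] using h 0
  · simpa [triExp] using h 1
  · simpa [triExp] using h 2
  · obtain ⟨h0, h1, h2⟩ := h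
    fin_cases i <;> simpa [triExp]

theorem triExp_sub (a b c a' b' c' : ℕ) :
    triExp a b c - triExp a' b' c' = triExp (a - a') (b - b') (c - c') := by
  ext i
  fin_cases i <;> simp [triExp]

variable {k}

/-- The coefficient of `x^a y^b z^c`. -/
def triCoeff (r : PS k) (a b c : ℕ) : k := coeff (triExp a b c) r

theorem triCoeff_ext {r r' : PS k} (h : ∀ a b c, triCoeff r a b c = triCoeff r' a b c) :
    r = r' := by
  ext d
  rw [eq_triExp d]
  exact h _ _ _

/-- The power series with prescribed coefficients. -/
def ofTriCoeff (F : ℕ → ℕ → ℕ → k) : PS k := fun d => F (d 0) (d 1) (d 2)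

theorem triCoeff_ofTriCoeff (F : ℕ → ℕ → ℕ → k) (a b c : ℕ) :
    triCoeff (ofTriCoeff F) a b c = F a b c := by
  change F _ _ _ = _
  rw [triExp_zero, triExp_one, triExp_two]

theorem triCoeff_add (r r' : PS k) (a b c : ℕ) :
    triCoeff (r + r') a b c = triCoeff r a b c + triCoeff r' a b c := map_add _ _ _

theorem triCoeff_sub (r r' : PS k) (a b c : ℕ) :
    triCoeff (r - r') a b c = triCoeff r a b c - triCoeff r' a b c := map_sub _ _ _

theorem triCoeff_sum {ι : Type*} (t : Finset ι) (r : ι → PS k) (a b c : ℕ) :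
    triCoeff (∑ i ∈ t, r i) a b c = ∑ i ∈ t, triCoeff (r i) a b c := map_sum _ _ _

theorem triCoeff_C_mul (u : k) (r : PS k) (a b c : ℕ) :
    triCoeff (C u * r) a b c = u * triCoeff r a b c := coeff_C_mul _ _ _

theorem triCoeff_one (a b c : ℕ) :
    triCoeff (1 : PS k) a b c = if a = 0 ∧ b = 0 ∧ c = 0 then 1 else 0 := by
  classical
  rw [triCoeff, coeff_one]
  congr 1
  refine propext ⟨fun h => ⟨?_, ?_, ?_⟩, ?_⟩
  · simpa [triExp] using DFunLike.congr_fun h 0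
  · simpa [triExp] using DFunLike.congr_fun h 1
  · simpa [triExp] using DFunLike.congr_fun h 2
  · rintro ⟨rfl, rfl, rfl⟩
    simp [triExp]

theorem triCoeff_mul_monomial (r : PS k) (i j l a b c : ℕ) :
    triCoeff (r * (X 0 ^ i * X 1 ^ j * X 2 ^ l)) a b c =
      if i ≤ a ∧ j ≤ b ∧ l ≤ c then triCoeff r (a - i) (b - j) (c - l) else 0 := by
  have h : (X 0 ^ i * X 1 ^ j * X 2 ^ l : PS k) = monomial (triExp i j l) 1 := by
    simp only [X_pow_eq, monomial_mul_monomial, triExp, mul_one]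
  rw [h, triCoeff, coeff_mul_monomial, triCoeff, ← triExp_sub]
  simp only [triExp_le, mul_one]

theorem triCoeff_mul_X0_pow (r : PS k) (i a b c : ℕ) :
    triCoeff (r * X 0 ^ i) a b c = if i ≤ a then triCoeff r (a - i) b c else 0 := by
  simpa using triCoeff_mul_monomial r i 0 0 a b c

theorem triCoeff_mul_X1_pow (r : PS k) (j a b c : ℕ) :
    triCoeff (r * X 1 ^ j) a b c = if j ≤ b then triCoeff r a (b - j) c else 0 := by
  simpa using triCoeff_mul_monomial r 0 j 0 a b c

theorem triCoeff_mul_X2_pow (r : PS k) (l a b c : ℕ) :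
    triCoeff (r * X 2 ^ l) a b c = if l ≤ c then triCoeff r a b (c - l) else 0 := by
  simpa using triCoeff_mul_monomial r 0 0 l a b c

theorem triCoeff_sq [CharP k 2] (r : PS k) (a b c : ℕ) :
    triCoeff (r ^ 2) (2 * a) (2 * b) (2 * c) = triCoeff r a b c ^ 2 := by
  have : Fact (Nat.Prime 2) := ⟨Nat.prime_two⟩
  have : ExpChar k 2 := ExpChar.prime Nat.prime_two
  have h : triExp (2 * a) (2 * b) (2 * c) = 2 • triExp a b c := by
    ext i
    fin_cases i <;> simp [triExp]
  rw [triCoeff, ← map_frobenius_expand 2 two_ne_zero, coeff_map, h, coeff_expand_smul, frobenius_def]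
  rfl

theorem triCoeff_sq_of_odd [CharP k 2] (r : PS k) (a b c : ℕ)
    (h : ¬ (2 ∣ a ∧ 2 ∣ b ∧ 2 ∣ c)) : triCoeff (r ^ 2) a b c = 0 := by
  have : Fact (Nat.Prime 2) := ⟨Nat.prime_two⟩
  have : ExpChar k 2 := ExpChar.prime Nat.prime_two
  obtain ⟨i, hi⟩ : ∃ i, ¬ 2 ∣ triExp a b c i := by
    by_contra! hh
    exact h ⟨by simpa [triExp] using hh 0, by simpa [triExp] using hh 1,
      by simpa [triExp] using hh 2⟩
  rw [triCoeff, ← map_frobenius_expand 2 two_ne_zero, coeff_map,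
    coeff_expand_of_not_dvd 2 two_ne_zero _ hi, map_zero]

/-- Power series in `x, y` only. -/
def ZFree (p : PS k) : Prop := ∀ a b c, c ≠ 0 → triCoeff p a b c = 0

theorem ZFree.add {p q : PS k} (hp : ZFree p) (hq : ZFree q) : ZFree (p + q) := by
  intro a b c hc
  rw [triCoeff_add, hp a b c hc, hq a b c hc, add_zero]

theorem ZFree.mul_monomial {p : PS k} (hp : ZFree p) (i j : ℕ) :
    ZFree (p * (X 0 ^ i * X 1 ^ j)) := by
  intro a b c hc
  have := triCoeff_mul_monomial p i j 0 a b c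
  rw [pow_zero, mul_one] at this
  rw [this]
  split_ifs
  · exact hp _ _ _ (by simpa using hc)
  · rfl

theorem ZFree.sq [CharP k 2] {p : PS k} (hp : ZFree p) : ZFree (p ^ 2) := by
  intro a b c hc
  by_cases h : 2 ∣ a ∧ 2 ∣ b ∧ 2 ∣ c
  · obtain ⟨⟨a, rfl⟩, ⟨b, rfl⟩, ⟨c, rfl⟩⟩ := h
    rw [triCoeff_sq, hp _ _ _ (by omega), zero_pow two_ne_zero]
  · exact triCoeff_sq_of_odd _ _ _ _ h

/-- The coefficients of `x^a y^b z^c` with `a, b < n` vanish, that is,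
the power series lies in the ideal `(x^n, y^n)`. -/
def BoxZero (n : ℕ) (r : PS k) : Prop := ∀ a b c, a < n → b < n → triCoeff r a b c = 0

theorem boxZero_iff {n : ℕ} {r : PS k} :
    BoxZero n r ↔ ∃ α β : PS k, r = α * X 0 ^ n + β * X 1 ^ n := by
  constructor
  · intro h
    refine ⟨ofTriCoeff fun a b c => triCoeff r (a + n) b c,
      ofTriCoeff fun a b c => if a < n then triCoeff r a (b + n) c else 0,
      triCoeff_ext fun a b c => ?_⟩
    rw [triCoeff_add, triCoeff_mul_X0_pow, triCoeff_mul_X1_pow, triCoeff_ofTriCoeff,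
      triCoeff_ofTriCoeff]
    by_cases ha : n ≤ a
    · simp [ha, Nat.not_lt.2 ha]
    · by_cases hb : n ≤ b
      · simp [hb, ha, Nat.not_le.1 ha]
      · simpa [ha, hb] using h a b c (by omega) (by omega)
  · rintro ⟨α, β, rfl⟩ a b c ha hb
    rw [triCoeff_add, triCoeff_mul_X0_pow, triCoeff_mul_X1_pow, if_neg (by omega),
      if_neg (by omega), add_zero]

/-- The equation `z^2 + x^2 y + z y^m + z x y^t`. -/
def dEq (k : Type) [Field k] (m t : ℕ) : PS k :=
  X 2 ^ 2 + X 0 ^ 2 * X 1 + X 2 * X 1 ^ m + X 2 * X 0 * X 1 ^ t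

theorem triCoeff_mul_dEq (r : PS k) (m t a b c : ℕ) :
    triCoeff (r * dEq k m t) a b c =
      (if 2 ≤ c then triCoeff r a b (c - 2) else 0) +
      (if 2 ≤ a ∧ 1 ≤ b then triCoeff r (a - 2) (b - 1) c else 0) +
      (if m ≤ b ∧ 1 ≤ c then triCoeff r a (b - m) (c - 1) else 0) +
      (if 1 ≤ a ∧ t ≤ b ∧ 1 ≤ c then triCoeff r (a - 1) (b - t) (c - 1) else 0) := by
  have h : r * dEq k m t = r * (X 0 ^ 0 * X 1 ^ 0 * X 2 ^ 2) + r * (X 0 ^ 2 * X 1 ^ 1 * X 2 ^ 0) +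
      r * (X 0 ^ 0 * X 1 ^ m * X 2 ^ 1) + r * (X 0 ^ 1 * X 1 ^ t * X 2 ^ 1) := by
    rw [dEq]
    ring
  rw [h, triCoeff_add, triCoeff_add, triCoeff_add]
  simp only [triCoeff_mul_monomial, Nat.zero_le, true_and, and_true, Nat.sub_zero]

/-- The coefficients of the quotient in the Weierstrass division by `dEq k m t`. -/
def divCoeff (m t : ℕ) (r : PS k) (a b c : ℕ) : k :=
  triCoeff r a b (c + 2) -
    (if 2 ≤ a ∧ 1 ≤ b then divCoeff m t r (a - 2) (b - 1) (c + 2) else 0) -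
    (if m ≤ b ∧ 1 ≤ m then divCoeff m t r a (b - m) (c + 1) else 0) -
    (if 1 ≤ a ∧ t ≤ b then divCoeff m t r (a - 1) (b - t) (c + 1) else 0)
termination_by a + b
decreasing_by all_goals omega

theorem exists_div_dEq {m : ℕ} (t : ℕ) (hm : 1 ≤ m) (r : PS k) :
    ∃ p q γ : PS k, ZFree p ∧ ZFree q ∧ r = p + q * X 2 + γ * dEq k m t := by
  set γ : PS k := ofTriCoeff (divCoeff m t r) with hγ
  have hγc : ∀ a b c, triCoeff γ a b c = divCoeff m t r a b c := triCoeff_ofTriCoeff _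
  set w : PS k := r - γ * dEq k m t with hw
  have hwc : ∀ a b c, triCoeff w a b (c + 2) = 0 := by
    intro a b c
    rw [hw, triCoeff_sub, triCoeff_mul_dEq]
    simp only [hγc]
    rw [divCoeff.eq_def m t r a b (c + 2 - 2)]
    simp [hm]
    ring
  refine ⟨ofTriCoeff fun a b c => if c = 0 then triCoeff w a b 0 else 0,
    ofTriCoeff fun a b c => if c = 0 then triCoeff w a b 1 else 0, γ, ?_, ?_, ?_⟩
  · intro a b c hc
    rw [triCoeff_ofTriCoeff, if_neg hc]
  · intro a b c hc
    rw [triCoeff_ofTriCoeff, if_neg hc]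
  · rw [← sub_eq_iff_eq_add, ← hw]
    refine triCoeff_ext fun a b c => ?_
    have h2 := triCoeff_mul_X2_pow
      (ofTriCoeff fun a b c => if c = 0 then triCoeff w a b 1 else 0) 1 a b c
    rw [pow_one] at h2
    rw [triCoeff_add, h2, triCoeff_ofTriCoeff, triCoeff_ofTriCoeff]
    match c with
    | 0 => simp
    | 1 => simp
    | c + 2 => simp [hwc]

theorem boxZero_of_mem {m t n : ℕ} (hm : 1 ≤ m) {p q γ w : PS k} (hp : ZFree p)
    (hq : ZFree q) (hw : BoxZero n w) (h : p + q * X 2 + γ * dEq k m t = w) :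
    BoxZero n p ∧ BoxZero n q := by
  have hq2 := fun a b c => triCoeff_mul_X2_pow q 1 a b c
  simp only [pow_one] at hq2
  have hc : ∀ a b c, a < n → b < n → triCoeff p a b c +
      (if 1 ≤ c then triCoeff q a b (c - 1) else 0) + triCoeff (γ * dEq k m t) a b c = 0 := by
    intro a b c ha hb
    rw [← hq2, ← triCoeff_add, ← triCoeff_add, h, hw a b c ha hb]
  have hγ : ∀ N a b, a + b = N → a < n → b < n → ∀ c, triCoeff γ a b c = 0 := by
    intro N
    induction N using Nat.strong_induction_on with
    | _ N ih =>
      intro a b hN ha hb c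
      have := hc a b (c + 2) ha hb
      rw [hp _ _ _ (by omega), if_pos (by omega), hq _ _ _ (by omega), triCoeff_mul_dEq,
        if_pos (by omega), Nat.add_sub_cancel] at this
      have h1 : (if 2 ≤ a ∧ 1 ≤ b then triCoeff γ (a - 2) (b - 1) (c + 2) else 0) = 0 := by
        split_ifs with hh
        · exact ih _ (by omega) _ _ rfl (by omega) (by omega) _
        · rfl
      have h2 : (if m ≤ b ∧ 1 ≤ c + 2 then triCoeff γ a (b - m) (c + 2 - 1) else 0) = 0 := by
        split_ifs with hh
        · exact ih _ (by omega) _ _ rfl (by omega) (by omega) _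
        · rfl
      have h3 : (if 1 ≤ a ∧ t ≤ b ∧ 1 ≤ c + 2 then
          triCoeff γ (a - 1) (b - t) (c + 2 - 1) else 0) = 0 := by
        split_ifs with hh
        · exact ih _ (by omega) _ _ rfl (by omega) (by omega) _
        · rfl
      rw [h1, h2, h3] at this
      simpa using this
  have hγf : ∀ a b c, a < n → b < n → triCoeff (γ * dEq k m t) a b c = 0 := by
    intro a b c ha hb
    rw [triCoeff_mul_dEq, hγ _ a b rfl ha hb, hγ _ (a - 2) (b - 1) rfl (by omega) (by omega),
      hγ _ a (b - m) rfl (by omega) (by omega), hγ _ (a - 1) (b - t) rfl (by omega) (by omega)]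
    simp
  constructor
  · intro a b c ha hb
    by_cases h0 : c = 0
    · subst h0
      simpa [hγf a b 0 ha hb] using hc a b 0 ha hb
    · exact hp _ _ _ h0
  · intro a b c ha hb
    by_cases h0 : c = 0
    · subst h0
      simpa [hγf a b 1 ha hb, hp a b 1 one_ne_zero] using hc a b 1 ha hb
    · exact hq _ _ _ h0

/-- The description of the Frobenius-nilpotent classes `(p + q z) / (x y)^n`: `p` contributes
nothing, and `q` contributes only multiples of `1 / (x y^j)` with `j ≤ B`. -/
def NilShape (B n : ℕ) (p q : PS k) : Prop :=
  BoxZero n p ∧ ∀ a b, a < n → b < n → a + 1 < n ∨ b + B < n → triCoeff q a b 0 = 0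

theorem nilShape_of_sq [CharP k 2] {m t B n : ℕ} (hB : B = min (m / 2) (t - 1)) (ht : 1 ≤ t)
    {p q : PS k} (hp : ZFree p)
    (h : NilShape B (2 * n) (p ^ 2 + q ^ 2 * (X 0 ^ 2 * X 1 ^ 1))
      (q ^ 2 * (X 0 ^ 0 * X 1 ^ m) + q ^ 2 * (X 0 ^ 1 * X 1 ^ t))) :
    NilShape B n p q := by
  have mon : ∀ i j a b, triCoeff (q ^ 2 * (X 0 ^ i * X 1 ^ j)) a b 0 =
      if i ≤ a ∧ j ≤ b then triCoeff (q ^ 2) (a - i) (b - j) 0 else 0 := by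
    intro i j a b
    simpa using triCoeff_mul_monomial (q ^ 2) i j 0 a b 0
  have sq := fun r : PS k => fun a b => triCoeff_sq r a b 0
  simp only [mul_zero] at sq
  obtain ⟨h1, h2⟩ := h
  have h1 : ∀ a b, a < 2 * n → b < 2 * n → triCoeff (p ^ 2) a b 0 +
      (if 2 ≤ a ∧ 1 ≤ b then triCoeff (q ^ 2) (a - 2) (b - 1) 0 else 0) = 0 := by
    intro a b ha hb
    rw [← mon, ← triCoeff_add, h1 a b 0 ha hb]
  have h2 : ∀ a b, a < 2 * n → b < 2 * n → a + 1 < 2 * n ∨ b + B < 2 * n →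
      (if m ≤ b then triCoeff (q ^ 2) a (b - m) 0 else 0) +
      (if 1 ≤ a ∧ t ≤ b then triCoeff (q ^ 2) (a - 1) (b - t) 0 else 0) = 0 := by
    intro a b ha hb hab
    have := h2 a b ha hb hab
    rw [triCoeff_add, mon, mon] at this
    simpa using this
  refine ⟨?_, ?_⟩
  · intro a b c ha hb
    by_cases hc : c = 0
    · subst hc
      have := h1 (2 * a) (2 * b) (by omega) (by omega)
      rw [sq] at this
      have h0 : (if 2 ≤ 2 * a ∧ 1 ≤ 2 * b then
          triCoeff (q ^ 2) (2 * a - 2) (2 * b - 1) 0 else 0) = 0 := by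
        split_ifs
        · exact triCoeff_sq_of_odd _ _ _ _ (by omega)
        · rfl
      rw [h0, add_zero] at this
      exact pow_eq_zero_iff two_ne_zero |>.1 this
    · exact hp _ _ _ hc
  · intro a b ha hb hab
    by_cases ha1 : a + 1 < n
    · have := h1 (2 * a + 2) (2 * b + 1) (by omega) (by omega)
      rw [triCoeff_sq_of_odd _ _ _ _ (by omega), if_pos (by omega), Nat.add_sub_cancel,
        Nat.add_sub_cancel, sq, zero_add] at this
      exact pow_eq_zero_iff two_ne_zero |>.1 this
    · by_cases hbm : 2 * b + m < 2 * n
      · have := h2 (2 * a) (2 * b + m) (by omega) hbm (by omega)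
        rw [if_pos (by omega), Nat.add_sub_cancel, sq] at this
        have h0 : (if 1 ≤ 2 * a ∧ t ≤ 2 * b + m then
            triCoeff (q ^ 2) (2 * a - 1) (2 * b + m - t) 0 else 0) = 0 := by
          split_ifs
          · exact triCoeff_sq_of_odd _ _ _ _ (by omega)
          · rfl
        rw [h0, add_zero] at this
        exact pow_eq_zero_iff two_ne_zero |>.1 this
      · have := h2 (2 * a + 1) (2 * b + t) (by omega) (by omega) (by omega)
        rw [if_pos (show 1 ≤ 2 * a + 1 ∧ t ≤ 2 * b + t by omega), Nat.add_sub_cancel,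
          Nat.add_sub_cancel, sq] at this
        have h0 : (if m ≤ 2 * b + t then
            triCoeff (q ^ 2) (2 * a + 1) (2 * b + t - m) 0 else 0) = 0 := by
          split_ifs
          · exact triCoeff_sq_of_odd _ _ _ _ (by omega)
          · rfl
        rw [h0, zero_add] at this
        exact pow_eq_zero_iff two_ne_zero |>.1 this

/-- The fraction `r / (x y)^n` in `L`. -/
def fracXY (f : PS k) (r : Rq k f) (n : ℕ) : Lloc k f :=
  Localization.mk r ⟨(xR k f * yR k f) ^ n, n, rfl⟩

theorem exists_fracXY (f : PS k) (c : Lloc k f) : ∃ r n, c = fracXY f r n := by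
  induction c using Localization.induction_on with
  | H y =>
    obtain ⟨r, _, n, rfl⟩ := y
    exact ⟨r, n, rfl⟩

theorem fracXY_eq_iff {f : PS k} {r r' : Rq k f} {n n' : ℕ} :
    fracXY f r n = fracXY f r' n' ↔ ∃ l, (xR k f * yR k f) ^ l * ((xR k f * yR k f) ^ n' * r) =
      (xR k f * yR k f) ^ l * ((xR k f * yR k f) ^ n * r') := by
  rw [fracXY, fracXY, Localization.mk_eq_mk_iff, Localization.r_iff_exists]
  constructor
  · rintro ⟨⟨_, l, rfl⟩, h⟩
    exact ⟨l, h⟩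
  · rintro ⟨l, h⟩
    exact ⟨⟨_, l, rfl⟩, h⟩

theorem fracXY_shift {f : PS k} (r : Rq k f) (n l : ℕ) :
    fracXY f (r * (xR k f * yR k f) ^ l) (n + l) = fracXY f r n := by
  rw [fracXY_eq_iff]
  exact ⟨0, by ring⟩

theorem fracXY_add {f : PS k} (r r' : Rq k f) (n : ℕ) :
    fracXY f r n + fracXY f r' n = fracXY f (r + r') n :=
  Localization.add_mk_self _ _ _

theorem fracXY_sub {f : PS k} (r r' : Rq k f) (n : ℕ) :
    fracXY f r n - fracXY f r' n = fracXY f (r - r') n := by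
  rw [sub_eq_iff_eq_add, fracXY_add, sub_add_cancel]

theorem fracXY_zero (f : PS k) (n : ℕ) : fracXY f 0 n = 0 := Localization.mk_zero _

theorem fracXY_sum {f : PS k} {ι : Type*} (t : Finset ι) (r : ι → Rq k f) (n : ℕ) :
    ∑ i ∈ t, fracXY f (r i) n = fracXY f (∑ i ∈ t, r i) n := by
  classical
  induction t using Finset.induction_on with
  | empty => simp [fracXY_zero]
  | insert i t hi ih => rw [Finset.sum_insert hi, Finset.sum_insert hi, ih, fracXY_add]

theorem fracXY_pow {f : PS k} (r : Rq k f) (n e : ℕ) :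
    fracXY f r n ^ e = fracXY f (r ^ e) (n * e) := by
  rw [fracXY, Localization.mk_pow, fracXY]
  congr 1
  exact Subtype.ext (pow_mul _ _ _).symm

theorem smul_fracXY {f : PS k} (s r : Rq k f) (n : ℕ) :
    s • fracXY f r n = fracXY f (s * r) n :=
  Localization.smul_mk _ _ _

theorem eq_fracXY {f : PS k} {c : Lloc k f} {r : Rq k f} {n : ℕ}
    (h : c * algebraMap (Rq k f) (Lloc k f) ((xR k f * yR k f) ^ n) =
      algebraMap (Rq k f) (Lloc k f) r) : c = fracXY f r n := by
  rw [fracXY, Localization.mk_eq_mk']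
  exact IsLocalization.eq_mk'_iff_mul_eq.2 h

theorem phiX_algebraMap (f : PS k) (a : Rq k f) :
    phiX k f (algebraMap _ _ a) = algebraMap (Rq k f) (Lloc k f) a :=
  IsLocalization.Away.awayToAwayRight_eq _ _ _

theorem phiY_algebraMap (f : PS k) (a : Rq k f) :
    phiY k f (algebraMap _ _ a) = algebraMap (Rq k f) (Lloc k f) a :=
  IsLocalization.Away.awayToAwayLeft_eq _ _ _

theorem phiX_eq_fracXY {f : PS k} {d : Localization.Away (xR k f)} {a : Rq k f} {i : ℕ}
    (h : d * algebraMap _ _ (xR k f ^ i) = algebraMap _ _ a) :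
    phiX k f d = fracXY f (a * yR k f ^ i) i := by
  apply eq_fracXY
  have h := congrArg (phiX k f) h
  rw [map_mul, phiX_algebraMap, phiX_algebraMap] at h
  rw [mul_pow, map_mul, map_mul, ← h, mul_assoc]

theorem phiY_eq_fracXY {f : PS k} {d : Localization.Away (yR k f)} {a : Rq k f} {i : ℕ}
    (h : d * algebraMap _ _ (yR k f ^ i) = algebraMap _ _ a) :
    phiY k f d = fracXY f (a * xR k f ^ i) i := by
  apply eq_fracXY
  have h := congrArg (phiY k f) h
  rw [map_mul, phiY_algebraMap, phiY_algebraMap] at h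
  rw [mul_pow, map_mul, map_mul, ← h, mul_comm (algebraMap _ _ (xR k f ^ i)), mul_assoc]

theorem mem_Asub_iff {f : PS k} {c : Lloc k f} :
    c ∈ Asub k f ↔ ∃ (n : ℕ) (α β : Rq k f),
      c = fracXY f (α * xR k f ^ n + β * yR k f ^ n) n := by
  constructor
  · intro h
    induction h using Submodule.span_induction with
    | mem c h =>
      rcases h with ⟨d, rfl⟩ | ⟨d, rfl⟩
      · obtain ⟨i, a, h⟩ := IsLocalization.Away.surj (xR k f) d
        rw [← map_pow] at h
        exact ⟨i, 0, a, by rw [phiX_eq_fracXY h, zero_mul, zero_add]⟩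
      · obtain ⟨i, a, h⟩ := IsLocalization.Away.surj (yR k f) d
        rw [← map_pow] at h
        exact ⟨i, a, 0, by rw [phiY_eq_fracXY h, zero_mul, add_zero]⟩
    | zero => exact ⟨0, 0, 0, by simp [fracXY_zero]⟩
    | add c c' _ _ h h' =>
      obtain ⟨n, α, β, rfl⟩ := h
      obtain ⟨n', α', β', rfl⟩ := h'
      refine ⟨n + n', α * yR k f ^ n' + α' * yR k f ^ n, β * xR k f ^ n' + β' * xR k f ^ n, ?_⟩
      rw [← fracXY_shift _ n n', ← fracXY_shift (_ + _) n' n, add_comm n' n, fracXY_add]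
      congr 1
      ring
    | smul a c _ h =>
      obtain ⟨n, α, β, rfl⟩ := h
      refine ⟨n, a * α, a * β, ?_⟩
      rw [smul_fracXY]
      congr 1
      ring
  · rintro ⟨n, α, β, rfl⟩
    rw [← fracXY_add]
    refine add_mem (Submodule.subset_span (Or.inr ?_)) (Submodule.subset_span (Or.inl ?_))
    · refine ⟨IsLocalization.mk' _ α (⟨_, n, rfl⟩ : Submonoid.powers (yR k f)), ?_⟩
      exact phiY_eq_fracXY (IsLocalization.mk'_spec _ α _)
    · refine ⟨IsLocalization.mk' _ β (⟨_, n, rfl⟩ : Submonoid.powers (xR k f)), ?_⟩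
      exact phiX_eq_fracXY (IsLocalization.mk'_spec _ β _)

theorem exists_of_fracXY_mem {f : PS k} {r : Rq k f} {n : ℕ} (h : fracXY f r n ∈ Asub k f) :
    ∃ (l : ℕ) (α β : Rq k f), r * (xR k f * yR k f) ^ l =
      α * xR k f ^ (n + l) + β * yR k f ^ (n + l) := by
  obtain ⟨N, α, β, h⟩ := mem_Asub_iff.1 h
  obtain ⟨l, h⟩ := fracXY_eq_iff.1 h
  refine ⟨l + N, α * yR k f ^ (n + l), β * xR k f ^ (n + l), ?_⟩
  linear_combination h

theorem sq_mem_Asub [CharP k 2] {f : PS k} {c : Lloc k f} (h : c ∈ Asub k f) :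
    c ^ 2 ∈ Asub k f := by
  have h2 : (2 : Rq k f) = 0 := by
    have := congrArg (algebraMap k (Rq k f)) (CharTwo.two_eq_zero (R := k))
    rwa [map_ofNat, map_zero] at this
  obtain ⟨n, α, β, rfl⟩ := mem_Asub_iff.1 h
  rw [fracXY_pow]
  refine mem_Asub_iff.2 ⟨n * 2, α ^ 2, β ^ 2, ?_⟩
  congr 1
  linear_combination α * xR k f ^ n * β * yR k f ^ n * h2

theorem pow_mem_Asub_of_sub_mem [CharP k 2] {f : PS k} {c c' : Lloc k f} (h : c - c' ∈ Asub k f)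
    {e : ℕ} (h' : c' ^ 2 ^ e ∈ Asub k f) : c ^ 2 ^ e ∈ Asub k f := by
  have h2 : (2 : Lloc k f) = 0 := by
    have := congrArg (algebraMap k (Lloc k f)) (CharTwo.two_eq_zero (R := k))
    rwa [map_ofNat, map_zero] at this
  induction e generalizing c c' with
  | zero => simpa using add_mem h h'
  | succ e ih =>
    rw [pow_succ', pow_mul] at h' ⊢
    refine ih ?_ h'
    have : c ^ 2 - c' ^ 2 = (c - c') ^ 2 := by linear_combination (c - c') * c' * h2
    rw [this]
    exact sq_mem_Asub h

theorem mk_eq_mk_iff_exists {f r r' : PS k} :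
    (Ideal.Quotient.mk (Ideal.span {f}) r = Ideal.Quotient.mk (Ideal.span {f}) r') ↔
      ∃ γ, r - r' = γ * f := by
  rw [Ideal.Quotient.eq, Ideal.mem_span_singleton']
  exact exists_congr fun γ => eq_comm

theorem boxZero_of_mul_monomial {p : PS k} {n l : ℕ}
    (h : BoxZero (n + l) (p * (X 0 ^ l * X 1 ^ l))) : BoxZero n p := by
  intro a b c ha hb
  have := h (a + l) (b + l) c (by omega) (by omega)
  have h' := triCoeff_mul_monomial p l l 0 (a + l) (b + l) c
  rw [pow_zero, mul_one] at h'
  rw [h'] at this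
  simpa using this

theorem boxZero_of_fracXY_mem {m t n : ℕ} (hm : 1 ≤ m) {p q : PS k} (hp : ZFree p)
    (hq : ZFree q)
    (h : fracXY (dEq k m t) (Ideal.Quotient.mk _ (p + q * X 2)) n ∈ Asub k (dEq k m t)) :
    BoxZero n p ∧ BoxZero n q := by
  obtain ⟨l, α, β, h⟩ := exists_of_fracXY_mem h
  obtain ⟨α, rfl⟩ := Ideal.Quotient.mk_surjective α
  obtain ⟨β, rfl⟩ := Ideal.Quotient.mk_surjective β
  simp only [xR, yR, ← map_mul, ← map_pow, ← map_add] at h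
  obtain ⟨γ, h⟩ := mk_eq_mk_iff_exists.1 h
  obtain ⟨h1, h2⟩ := boxZero_of_mem (γ := -γ) (t := t) hm (hp.mul_monomial l l)
    (hq.mul_monomial l l) (boxZero_iff.2 ⟨α, β, rfl⟩)
    (show _ = α * X 0 ^ (n + l) + β * X 1 ^ (n + l) by linear_combination h)
  exact ⟨boxZero_of_mul_monomial h1, boxZero_of_mul_monomial h2⟩

theorem fracXY_mem_of_boxZero {f p q : PS k} {n : ℕ} (hp : BoxZero n p) (hq : BoxZero n q) :
    fracXY f (Ideal.Quotient.mk _ (p + q * X 2)) n ∈ Asub k f := by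
  obtain ⟨α, β, rfl⟩ := boxZero_iff.1 hp
  obtain ⟨α', β', rfl⟩ := boxZero_iff.1 hq
  refine mem_Asub_iff.2 ⟨n, Ideal.Quotient.mk _ (α + α' * X 2),
    Ideal.Quotient.mk _ (β + β' * X 2), ?_⟩
  congr 1
  simp only [xR, yR, ← map_mul, ← map_pow, ← map_add]
  congr 1
  ring

theorem two_eq_zero_PS (k : Type) [Field k] [CharP k 2] : (2 : PS k) = 0 := by
  have := congrArg (algebraMap k (PS k)) (CharTwo.two_eq_zero (R := k))
  rwa [map_ofNat, map_zero] at this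

theorem nilShape_of_pow_mem [CharP k 2] {m t B : ℕ} (hB : B = min (m / 2) (t - 1)) (hm : 1 ≤ m)
    (ht : 1 ≤ t) (e : ℕ) {n : ℕ} {p q : PS k} (hp : ZFree p) (hq : ZFree q)
    (h : fracXY (dEq k m t) (Ideal.Quotient.mk _ (p + q * X 2)) n ^ 2 ^ e ∈
      Asub k (dEq k m t)) : NilShape B n p q := by
  induction e generalizing n p q with
  | zero =>
    rw [pow_zero, pow_one] at h
    obtain ⟨h1, h2⟩ := boxZero_of_fracXY_mem hm hp hq h
    exact ⟨h1, fun a b ha hb _ => h2 a b 0 ha hb⟩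
  | succ e ih =>
    refine nilShape_of_sq (m := m) hB ht hp (ih (hp.sq.add (hq.sq.mul_monomial 2 1))
      ((hq.sq.mul_monomial 0 m).add (hq.sq.mul_monomial 1 t)) ?_)
    rw [pow_succ', pow_mul, fracXY_pow, ← map_pow, mul_comm n 2] at h
    convert h using 3
    refine mk_eq_mk_iff_exists.2 ⟨-q ^ 2, ?_⟩
    rw [dEq]
    linear_combination (q ^ 2 * (X 0 ^ 2 * X 1 + X 2 * X 1 ^ m + X 2 * X 0 * X 1 ^ t)
      - p * q * X 2) * two_eq_zero_PS k

/-- The numerator over `(x y)^n`, divided by `z`, of `∑ a_j z / (x y^j)`, for `1 ≤ j ≤ B`. -/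
def tailNum (a : ℕ → k) (B n : ℕ) : PS k :=
  ∑ j ∈ Finset.Icc 1 B, C (a j) * (1 * (X 0 ^ (n - 1) * X 1 ^ (n - j)))

theorem triCoeff_tailNum {a : ℕ → k} {B n : ℕ} (hn : B ≤ n) (u v w : ℕ) :
    triCoeff (tailNum a B n) u v w =
      if u = n - 1 ∧ w = 0 ∧ v < n ∧ n ≤ v + B then a (n - v) else 0 := by
  have key : ∀ j, triCoeff (C (a j) * (1 * (X 0 ^ (n - 1) * X 1 ^ (n - j))) : PS k) u v w =
      if u = n - 1 ∧ v = n - j ∧ w = 0 then a j else 0 := by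
    intro j
    have h := triCoeff_mul_monomial (1 : PS k) (n - 1) (n - j) 0 u v w
    rw [pow_zero, mul_one] at h
    rw [triCoeff_C_mul, h, triCoeff_one]
    split_ifs <;> first | omega | simp
  rw [tailNum, triCoeff_sum, Finset.sum_congr rfl fun j _ => key j]
  split_ifs with h
  · rw [Finset.sum_eq_single (n - v)]
    · rw [if_pos (by omega)]
    · intro j hj hjv
      rw [Finset.mem_Icc] at hj
      rw [if_neg (by omega)]
    · intro hj
      rw [Finset.mem_Icc] at hj
      omega
  · refine Finset.sum_eq_zero fun j hj => ?_
    rw [Finset.mem_Icc] at hj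
    rw [if_neg (by omega)]

theorem zFree_tailNum (a : ℕ → k) {B n : ℕ} (hn : B ≤ n) : ZFree (tailNum a B n) := by
  intro u v w hw
  rw [triCoeff_tailNum hn, if_neg (by omega)]

theorem fcls_eq_fracXY {f : PS k} {j n : ℕ} (hj : 1 ≤ j) (hn : j ≤ n) :
    fcls k f j = fracXY f (zR k f * (xR k f ^ (n - 1) * yR k f ^ (n - j))) n := by
  obtain ⟨l, rfl⟩ := Nat.exists_eq_add_of_le hn
  obtain ⟨j, rfl⟩ := Nat.exists_eq_add_of_le' hj
  change fracXY f _ _ = _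
  rw [← fracXY_shift _ (j + 1) l]
  congr 1
  rw [show j + 1 + l - 1 = j + l by omega, show j + 1 + l - (j + 1) = l by omega,
    Nat.add_sub_cancel]
  ring

theorem sum_fcls_eq {f : PS k} (a : ℕ → k) {B n : ℕ} (hn : B ≤ n) :
    ∑ j ∈ Finset.Icc 1 B, algebraMap k (Rq k f) (a j) • fcls k f j =
      fracXY f (Ideal.Quotient.mk _ (tailNum a B n * X 2)) n := by
  have h : ∀ j ∈ Finset.Icc 1 B, algebraMap k (Rq k f) (a j) • fcls k f j =
      fracXY f (Ideal.Quotient.mk _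
        (C (a j) * (1 * (X 0 ^ (n - 1) * X 1 ^ (n - j))) * X 2)) n := by
    intro j hj
    rw [Finset.mem_Icc] at hj
    rw [fcls_eq_fracXY hj.1 (hj.2.trans hn), smul_fracXY]
    congr 1
    have ha : algebraMap k (Rq k f) (a j) = Ideal.Quotient.mk _ (C (a j)) := rfl
    rw [ha]
    simp only [map_mul, map_pow, map_one]
    ring
  rw [Finset.sum_congr rfl h, fracXY_sum, tailNum, Finset.sum_mul, map_sum]

theorem coeff_eq_zero_of_sum_fcls_mem {m t B : ℕ} (hm : 1 ≤ m) (a : ℕ → k)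
    (h : (∑ j ∈ Finset.Icc 1 B, algebraMap k (Rq k (dEq k m t)) (a j) • fcls k (dEq k m t) j)
      ∈ Asub k (dEq k m t)) : ∀ j ∈ Finset.Icc 1 B, a j = 0 := by
  intro j hj
  rw [Finset.mem_Icc] at hj
  rw [sum_fcls_eq a le_rfl, ← zero_add (tailNum a B B * X 2)] at h
  have h0 : ZFree (0 : PS k) := fun _ _ _ _ => map_zero _
  have := (boxZero_of_fracXY_mem hm h0 (zFree_tailNum a le_rfl) h).2 (B - 1) (B - j) 0
    (by omega) (by omega)
  rwa [triCoeff_tailNum le_rfl, if_pos (by omega), show B - (B - j) = j by omega] at this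

theorem exists_sub_sum_fcls_mem [CharP k 2] {m t B : ℕ} (hB : B = min (m / 2) (t - 1))
    (hm : 1 ≤ m) (ht : 1 ≤ t) {c : Lloc k (dEq k m t)} {e : ℕ}
    (h : c ^ 2 ^ e ∈ Asub k (dEq k m t)) :
    ∃ a : ℕ → k, c - ∑ j ∈ Finset.Icc 1 B,
      algebraMap k (Rq k (dEq k m t)) (a j) • fcls k (dEq k m t) j ∈ Asub k (dEq k m t) := by
  obtain ⟨r, n, hn, rfl⟩ : ∃ r n, B ≤ n ∧ c = fracXY (dEq k m t) r n := by
    obtain ⟨r, n, rfl⟩ := exists_fracXY _ c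
    exact ⟨_, n + B, by omega, (fracXY_shift r n B).symm⟩
  obtain ⟨r, rfl⟩ := Ideal.Quotient.mk_surjective r
  obtain ⟨p, q, γ, hp, hq, hr⟩ := exists_div_dEq t hm r
  have hr : Ideal.Quotient.mk (Ideal.span {dEq k m t}) r = Ideal.Quotient.mk _ (p + q * X 2) :=
    mk_eq_mk_iff_exists.2 ⟨γ, by linear_combination hr⟩
  rw [hr] at h ⊢
  obtain ⟨h1, h2⟩ := nilShape_of_pow_mem hB hm ht e hp hq h
  refine ⟨fun j => triCoeff q (n - 1) (n - j) 0, ?_⟩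
  rw [sum_fcls_eq _ hn, fracXY_sub, ← map_sub, add_sub_assoc, ← sub_mul]
  refine fracXY_mem_of_boxZero h1 fun u v w hu hv => ?_
  rw [triCoeff_sub, triCoeff_tailNum hn]
  split_ifs with hc
  · obtain ⟨rfl, rfl, _, _⟩ := hc
    rw [show n - (n - v) = v by omega, sub_self]
  · rw [sub_zero]
    by_cases hw : w = 0
    · subst hw
      exact h2 u v hu hv (by omega)
    · exact hq _ _ _ hw

theorem exists_fcls_pow_mem [CharP k 2] {m t : ℕ} {j : ℕ} (hj : 1 ≤ j) (hjm : 2 * j ≤ m)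
    (hjt : j < t) : ∃ e : ℕ, fcls k (dEq k m t) j ^ 2 ^ e ∈ Asub k (dEq k m t) := by
  induction j using Nat.strong_induction_on with
  | _ j ih =>
  set x := xR k (dEq k m t) with hx
  set y := yR k (dEq k m t) with hy
  set z := zR k (dEq k m t) with hz
  have hrel : z ^ 2 = x ^ 2 * y + z * y ^ m + z * x * y ^ t := by
    simp only [hx, hy, hz, xR, yR, zR, ← map_mul, ← map_pow, ← map_add]
    refine mk_eq_mk_iff_exists.2 ⟨1, ?_⟩
    rw [dEq]
    linear_combination (-(X 0 ^ 2 * X 1 + X 2 * X 1 ^ m + X 2 * X 0 * X 1 ^ t)) *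
      two_eq_zero_PS k
  obtain ⟨i, rfl⟩ := Nat.exists_eq_add_of_le' hj
  obtain ⟨u, rfl⟩ := Nat.exists_eq_add_of_le' hjm
  have hsq : fcls k (dEq k (u + 2 * (i + 1)) t) (i + 1) ^ 2 =
      fracXY _ (y * x ^ (2 * (i + 1)) + z * y ^ u * x ^ (2 * i) * y ^ (2 * (i + 1)))
        (2 * (i + 1)) + fracXY _ (z * x ^ (2 * i + 1) * y ^ t) (2 * (i + 1)) := by
    change fracXY _ (z * x ^ i) _ ^ 2 = _
    rw [fracXY_pow, fracXY_add, mul_comm (i + 1) 2]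
    congr 1
    linear_combination x ^ (2 * i) * hrel
  have hA := mem_Asub_iff.2 ⟨2 * (i + 1), y, z * y ^ u * x ^ (2 * i), rfl⟩
  by_cases hti : 2 * (i + 1) ≤ t
  · refine ⟨1, ?_⟩
    rw [pow_one, hsq]
    refine add_mem hA ?_
    obtain ⟨v, rfl⟩ := Nat.exists_eq_add_of_le' hti
    refine mem_Asub_iff.2 ⟨2 * (i + 1), 0, z * x ^ (2 * i + 1) * y ^ v, ?_⟩
    congr 1
    ring
  · obtain ⟨e, he⟩ := ih (2 * (i + 1) - t) (by omega) (by omega) (by omega) (by omega)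
    refine ⟨e + 1, ?_⟩
    rw [pow_succ', pow_mul]
    refine pow_mem_Asub_of_sub_mem ?_ he
    rw [hsq, fcls_eq_fracXY (n := 2 * (i + 1)) (by omega) (by omega),
      show 2 * (i + 1) - 1 = 2 * i + 1 by omega,
      show 2 * (i + 1) - (2 * (i + 1) - t) = t by omega, ← mul_assoc, add_sub_cancel_right]
    exact hA

end

/-- Local cohomology of the rational double point of type D2m1_s
in characteristic 2: the Frobenius-nilpotent part `H^2_m(R)[F^∞]` of `L/A` has
k-basis the classes of `z/(x y^j)` for `j ≥ 1` with `2j-1 ≤ L' = min(m-1, 2m-2s-2)`;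
in particular it has dimension `⌊(L'+1)/2⌋`. -/
theorem localCohomology_D2m1_s (k : Type) [Field k] [IsAlgClosed k] [CharP k 2]
    (m s : ℕ) (hm : 2 ≤ m) (hr : s ≤ m - 1) :
    -- the defining equation of D2m1_s and the bound L'
    ∀ f : PS k, f = X 2 ^ 2 + X 0 ^ 2 * X 1 + X 2 * X 1 ^ m + X 2 * X 0 * X 1 ^ (m - s) →
    ∀ L' : ℕ, L' = min (m - 1) (2 * m - 2 * s - 2) →
    -- (i) each z/(x y^j) with 1 ≤ j and 2j - 1 ≤ L' is Frobenius-nilpotent modulo A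
    (∀ j : ℕ, 1 ≤ j → 2 * j - 1 ≤ L' →
      ∃ m' : ℕ, (fcls k f j) ^ 2 ^ m' ∈ Asub k f) ∧
    -- (ii) the classes of these elements in L/A are k-linearly independent
    (∀ a : ℕ → k,
      (∑ j ∈ Finset.Icc 1 ((L' + 1) / 2), algebraMap k (Rq k f) (a j) • fcls k f j)
        ∈ Asub k f →
      ∀ j ∈ Finset.Icc 1 ((L' + 1) / 2), a j = 0) ∧
    -- (iii) every Frobenius-nilpotent class is a k-linear combination of these classes
    (∀ c : Lloc k f, (∃ m' : ℕ, c ^ 2 ^ m' ∈ Asub k f) →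
      ∃ a : ℕ → k,
        c - ∑ j ∈ Finset.Icc 1 ((L' + 1) / 2), algebraMap k (Rq k f) (a j) • fcls k f j
          ∈ Asub k f) := by
  rintro f hf L' rfl
  have hf : f = dEq k m (m - s) := hf
  subst hf
  refine ⟨fun j hj hjL => ?_, fun a h => coeff_eq_zero_of_sum_fcls_mem (by omega) a h,
    fun c ⟨e, h⟩ => exists_sub_sum_fcls_mem (by omega) (by omega) (by omega) h⟩
  exact exists_fcls_pow_mem hj (by omega) (by omega)
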